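/- Let ε ≥ 0, let c1 ≥ c2 > 0 with c1 ≤ e^ε·c2, and let μ ∈ (0,1) with μ·c1 > (1−μ)·c2; set p0 := μ·c1/(μ·c1 + (1−μ)·c2), so p0 > 1/2. Let λ > 0 and let N be a positive integer with N ≥ (e^{2ε}/2)·(2(1+λ)/(λ(p0 − 1/2)))²·ln(4(1+λ)/(λ(p0 − 1/2))). Let θ := M/N where M ~ Binomial(N, μ), and set p_mmrc := E[ (θ·c1·1{θ ≤ μ} + (μ·c1 + (θ−μ)·c2)·1{θ > μ}) / (μ·c1 + (1−μ)·c2) ]. Then p0 − p_mmrc ≤ λ·(p0 − 1/2)/(1+λ). -/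

import Mathlib

open Real Finset

/-- The weight that the binomial distribution with parameters `N` and `μ` gives to `M`. -/
noncomputable def binomialWeight (N : ℕ) (μ : ℝ) (M : ℕ) : ℝ :=
  (N.choose M : ℝ) * μ ^ M * (1 - μ) ^ (N - M)

lemma binomialWeight_nonneg {μ : ℝ} (hμ0 : 0 ≤ μ) (hμ1 : μ ≤ 1) (N M : ℕ) :
    0 ≤ binomialWeight N μ M := by
  have : 0 ≤ 1 - μ := sub_nonneg.2 hμ1
  unfold binomialWeight
  positivity

lemma eval_bernsteinPolynomial (N M : ℕ) (μ : ℝ) :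
    (bernsteinPolynomial ℝ N M).eval μ = binomialWeight N μ M := by
  simp [bernsteinPolynomial, binomialWeight]

lemma sum_binomialWeight (N : ℕ) (μ : ℝ) :
    ∑ M ∈ range (N + 1), binomialWeight N μ M = 1 := by
  simpa [Polynomial.eval_finsetSum, eval_bernsteinPolynomial] using
    congrArg (Polynomial.eval μ) (bernsteinPolynomial.sum ℝ N)

lemma sum_binomialWeight_mul_sub {N : ℕ} (hN : 0 < N) (μ : ℝ) :
    ∑ M ∈ range (N + 1), binomialWeight N μ M * (μ - (M : ℝ) / N) = 0 := by
  have hN' : (N : ℝ) ≠ 0 := by positivity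
  have h : ∑ M ∈ range (N + 1), (M : ℝ) * binomialWeight N μ M = N * μ := by
    simpa [Polynomial.eval_finsetSum, eval_bernsteinPolynomial] using
      congrArg (Polynomial.eval μ) (bernsteinPolynomial.sum_smul ℝ N)
  calc ∑ M ∈ range (N + 1), binomialWeight N μ M * (μ - (M : ℝ) / N)
      = μ * ∑ M ∈ range (N + 1), binomialWeight N μ M
        - (∑ M ∈ range (N + 1), (M : ℝ) * binomialWeight N μ M) / N := by
        rw [mul_sum, sum_div, ← sum_sub_distrib]
        exact sum_congr rfl fun M _ => by ring
    _ = 0 := by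
        rw [sum_binomialWeight, h]
        field_simp
        ring

lemma sum_binomialWeight_mul_sub_sq {N : ℕ} (hN : 0 < N) (μ : ℝ) :
    ∑ M ∈ range (N + 1), binomialWeight N μ M * (μ - (M : ℝ) / N) ^ 2 = μ * (1 - μ) / N := by
  have hN' : (N : ℝ) ≠ 0 := by positivity
  have h : ∑ M ∈ range (N + 1), ((N : ℝ) * μ - M) ^ 2 * binomialWeight N μ M
      = N * μ * (1 - μ) := by
    simpa [Polynomial.eval_finsetSum, eval_bernsteinPolynomial] using
      congrArg (Polynomial.eval μ) (bernsteinPolynomial.variance ℝ N)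
  calc ∑ M ∈ range (N + 1), binomialWeight N μ M * (μ - (M : ℝ) / N) ^ 2
      = (∑ M ∈ range (N + 1), ((N : ℝ) * μ - M) ^ 2 * binomialWeight N μ M) / N ^ 2 := by
        rw [sum_div]
        exact sum_congr rfl fun M _ => by field_simp
    _ = μ * (1 - μ) / N := by
        rw [h]
        field_simp

/-- A piecewise linear function with slopes `c₁` below `0` and `c₂` above `0` lies below a
parabola tangent to its steeper branch. -/
lemma ite_slope_le {c₁ c₂ a : ℝ} (hc : c₂ ≤ c₁) (ha : 0 < a) (y : ℝ) :
    (if 0 ≤ y then c₁ * y else c₂ * y) ≤ (c₁ - c₂) * (a + y ^ 2 / (4 * a)) + c₂ * y := by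
  have hc' : 0 ≤ c₁ - c₂ := sub_nonneg.2 hc
  split_ifs
  · have hy : y ≤ a + y ^ 2 / (4 * a) := by
      have : a + y ^ 2 / (4 * a) - y = (2 * a - y) ^ 2 / (4 * a) := by
        field_simp
        ring
      have : 0 ≤ (2 * a - y) ^ 2 / (4 * a) := by positivity
      linarith
    nlinarith [mul_le_mul_of_nonneg_left hy hc']
  · have : 0 ≤ (c₁ - c₂) * (a + y ^ 2 / (4 * a)) := by positivity
    linarith

/-- The gap between `p0` and the cap probability of the selected candidate, for every choice of
the free parameter `a`. -/
lemma cap_prob_gap_le {c1 c2 μ a : ℝ} {N : ℕ} (hc2 : 0 < c2) (hc12 : c2 ≤ c1)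
    (hμ0 : 0 < μ) (hμ1 : μ < 1) (hN : 0 < N) (ha : 0 < a) :
    μ * c1 / (μ * c1 + (1 - μ) * c2) - (∑ M ∈ range (N + 1), binomialWeight N μ M *
          ((if (M : ℝ) / (N : ℝ) ≤ μ then ((M : ℝ) / (N : ℝ)) * c1
            else μ * c1 + ((M : ℝ) / (N : ℝ) - μ) * c2) /
            (μ * c1 + (1 - μ) * c2)))
      ≤ (c1 - c2) / (μ * c1 + (1 - μ) * c2) * (a + μ * (1 - μ) / N / (4 * a)) := by
  have hD : 0 < μ * c1 + (1 - μ) * c2 :=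
    add_pos (mul_pos hμ0 (hc2.trans_le hc12)) (mul_pos (sub_pos.2 hμ1) hc2)
  set D := μ * c1 + (1 - μ) * c2
  calc _ = ∑ M ∈ range (N + 1), binomialWeight N μ M *
          ((if 0 ≤ μ - (M : ℝ) / N then c1 * (μ - (M : ℝ) / N)
            else c2 * (μ - (M : ℝ) / N)) / D) := by
        rw [← mul_one (μ * c1 / D), ← sum_binomialWeight N μ, mul_sum, ← sum_sub_distrib]
        refine sum_congr rfl fun M _ => ?_
        simp only [sub_nonneg]
        split_ifs <;> ring
    _ ≤ ∑ M ∈ range (N + 1), binomialWeight N μ M *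
          (((c1 - c2) * (a + (μ - (M : ℝ) / N) ^ 2 / (4 * a)) + c2 * (μ - (M : ℝ) / N)) / D) :=
        sum_le_sum fun M _ => mul_le_mul_of_nonneg_left
          (div_le_div_of_nonneg_right (ite_slope_le hc12 ha _) hD.le)
          (binomialWeight_nonneg hμ0.le hμ1.le N M)
    _ = (c1 - c2) / D * (a * ∑ M ∈ range (N + 1), binomialWeight N μ M
          + (∑ M ∈ range (N + 1), binomialWeight N μ M * (μ - (M : ℝ) / N) ^ 2) / (4 * a))
          + c2 / D * ∑ M ∈ range (N + 1), binomialWeight N μ M * (μ - (M : ℝ) / N) := by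
        rw [mul_sum, sum_div, ← sum_add_distrib, mul_sum, mul_sum, ← sum_add_distrib]
        exact sum_congr rfl fun M _ => by ring
    _ = _ := by
        rw [sum_binomialWeight, sum_binomialWeight_mul_sub_sq hN,
          sum_binomialWeight_mul_sub hN, mul_one, mul_zero, add_zero]

/-- **Lemma H.1 (core estimate), MMRC simulating PrivUnit₂.**  With `θ = M/N`,
`M ~ Binomial(N, μ)`, and
`p_mmrc = E[(θc1·1{θ≤μ} + (μc1+(θ−μ)c2)·1{θ>μ})/(μc1+(1−μ)c2)]`, if
`N ≥ (e^{2ε}/2)·(2(1+λ)/(λ(p0−1/2)))²·ln(4(1+λ)/(λ(p0−1/2)))` then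
`p0 − p_mmrc ≤ λ(p0−1/2)/(1+λ)`. -/
theorem mmrc_privunit_cap_prob_close
    (ε c1 c2 μ : ℝ) (hε : 0 ≤ ε) (hc2 : 0 < c2) (hc12 : c2 ≤ c1)
    (hc1e : c1 ≤ Real.exp ε * c2)
    (hμ0 : 0 < μ) (hμ1 : μ < 1) (hcap : (1 - μ) * c2 < μ * c1)
    (p0 : ℝ) (hp0 : p0 = μ * c1 / (μ * c1 + (1 - μ) * c2))
    (lam : ℝ) (hlam : 0 < lam)
    (N : ℕ) (hN0 : 0 < N)
    (hN : (N : ℝ) ≥ (Real.exp (2 * ε) / 2) *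
        (2 * (1 + lam) / (lam * (p0 - 1 / 2))) ^ 2 *
        Real.log (4 * (1 + lam) / (lam * (p0 - 1 / 2)))) :
    p0 - (∑ M ∈ Finset.range (N + 1),
        (N.choose M : ℝ) * μ ^ M * (1 - μ) ^ (N - M) *
          ((if (M : ℝ) / (N : ℝ) ≤ μ then ((M : ℝ) / (N : ℝ)) * c1
            else μ * c1 + ((M : ℝ) / (N : ℝ) - μ) * c2) /
            (μ * c1 + (1 - μ) * c2)))
      ≤ lam * (p0 - 1 / 2) / (1 + lam) := by
  have hD : 0 < μ * c1 + (1 - μ) * c2 :=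
    add_pos (mul_pos hμ0 (hc2.trans_le hc12)) (mul_pos (sub_pos.2 hμ1) hc2)
  have hp_half : 1 / 2 < p0 := by
    rw [hp0, div_lt_div_iff₀ two_pos hD]
    linarith
  have hp_one : p0 < 1 := by
    rw [hp0, div_lt_one hD]
    linarith [mul_pos (sub_pos.2 hμ1) hc2]
  set δ := lam * (p0 - 1 / 2) / (1 + lam) with hδ_def
  have hq : 0 < p0 - 1 / 2 := sub_pos.2 hp_half
  have hδ : 0 < δ := by positivity
  have hδ_half : δ < 1 / 2 := by
    rw [hδ_def, div_lt_iff₀ (by positivity)]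
    nlinarith
  have hratio : 2 * (1 + lam) / (lam * (p0 - 1 / 2)) = 2 / δ := by
    rw [hδ_def]
    field_simp
  have hratio' : 4 * (1 + lam) / (lam * (p0 - 1 / 2)) = 4 / δ := by
    rw [hδ_def]
    field_simp
  have hlog : 1 / 2 ≤ Real.log (4 / δ) := by
    have h := Real.one_sub_inv_le_log_of_pos (show 0 < 4 / δ by positivity)
    rw [inv_div] at h
    linarith
  set E := Real.exp ε with hE_def
  have hE : 0 < E := Real.exp_pos ε
  have hE_sq : Real.exp (2 * ε) = E ^ 2 := by
    rw [hE_def, ← Real.exp_nat_mul]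
    norm_num
  rw [hratio, hratio', hE_sq] at hN
  have hN_pos : (0 : ℝ) < N := by positivity
  have hN_lower : E ^ 2 / δ ^ 2 ≤ N := by
    calc E ^ 2 / δ ^ 2 = E ^ 2 / 2 * (2 / δ) ^ 2 * (1 / 2) := by
          field_simp
      _ ≤ E ^ 2 / 2 * (2 / δ) ^ 2 * Real.log (4 / δ) := by gcongr
      _ ≤ N := hN
  have hvar : μ * (1 - μ) / N ≤ δ ^ 2 / E ^ 2 := by
    rw [div_le_iff₀ (by positivity)] at hN_lower
    rw [div_le_div_iff₀ hN_pos (by positivity)]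
    nlinarith [mul_nonneg (sq_nonneg E) (show 0 ≤ 1 - μ * (1 - μ) by nlinarith)]
  have hslope : (c1 - c2) / (μ * c1 + (1 - μ) * c2) ≤ E := by
    rw [div_le_iff₀ hD]
    nlinarith [mul_le_mul_of_nonneg_left hc12 hμ0.le,
      mul_le_mul_of_nonneg_left (show c2 ≤ μ * c1 + (1 - μ) * c2 by nlinarith) hE.le]
  have hvar_nonneg : 0 ≤ μ * (1 - μ) / N :=
    div_nonneg (mul_nonneg hμ0.le (sub_nonneg.2 hμ1.le)) hN_pos.le
  have ha : 0 < δ / (2 * E) := by positivity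
  rw [hp0]
  calc _ ≤ (c1 - c2) / (μ * c1 + (1 - μ) * c2) *
          (δ / (2 * E) + μ * (1 - μ) / N / (4 * (δ / (2 * E)))) :=
        cap_prob_gap_le hc2 hc12 hμ0 hμ1 hN0 ha
    _ ≤ E * (δ / (2 * E) + δ ^ 2 / E ^ 2 / (4 * (δ / (2 * E)))) := by gcongr
    _ = δ := by
        field_simp
        norm_num
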